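/- Let α > 0 and n ≥ 2. Then the regular zeros of X₁-Laguerre polynomials of consecutive degrees interlace: 0 < x̂_{n+1,2}^{(α)} < x̂_{n,2}^{(α)} < x̂_{n+1,3}^{(α)} < x̂_{n,3}^{(α)} < … < x̂_{n+1,n}^{(α)} < x̂_{n,n}^{(α)} < x̂_{n+1,n+1}^{(α)}. -/

import Mathlib

open Finset Filter

/-- The Jacobi polynomial `P_n^{(α,β)}(x)` via its explicit sum representation. -/
noncomputable def jacobiP (α β : ℝ) (n : ℕ) (x : ℝ) : ℝ :=
  ∑ s ∈ Finset.range (n + 1),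
    ((∏ j ∈ Finset.Icc (s + 1) n, (α + (j : ℝ))) / (Nat.factorial (n - s) : ℝ)) *
      ((∏ j ∈ Finset.Icc (n - s + 1) n, (β + (j : ℝ))) / (Nat.factorial s : ℝ)) *
      ((x - 1) / 2) ^ s * ((x + 1) / 2) ^ (n - s)

/-- The X₁-Jacobi polynomial `P̂_n^{(α,β)}(x)` for `n ≥ 1`, with `b = (β+α)/(β-α)`. -/
noncomputable def X1jacobiP (α β : ℝ) (n : ℕ) (x : ℝ) : ℝ :=
  -(1 / 2) * (x - (β + α) / (β - α)) * jacobiP α β (n - 1) x +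
    ((β + α) / (β - α) * jacobiP α β (n - 1) x -
        (if 2 ≤ n then jacobiP α β (n - 2) x else 0)) / (2 * (n : ℝ) - 2 + α + β)

/-- The generalized Laguerre polynomial `L_n^{(α)}(x)` via its explicit sum representation. -/
noncomputable def laguerreL (α : ℝ) (n : ℕ) (x : ℝ) : ℝ :=
  ∑ k ∈ Finset.range (n + 1),
    (-1 : ℝ) ^ k / (Nat.factorial k : ℝ) *
      ((∏ j ∈ Finset.Icc (k + 1) n, (α + (j : ℝ))) / (Nat.factorial (n - k) : ℝ)) * x ^ k

/-- The X₁-Laguerre polynomial `L̂_n^{(α)}(x)` for `n ≥ 1`. -/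
noncomputable def X1laguerreL (α : ℝ) (n : ℕ) (x : ℝ) : ℝ :=
  -(x + α + 1) * laguerreL α (n - 1) x + (if 2 ≤ n then laguerreL α (n - 2) x else 0)

/-- The physicist's Hermite polynomial `H_m(x)`. -/
noncomputable def hermiteH (m : ℕ) (x : ℝ) : ℝ :=
  (Nat.factorial m : ℝ) *
    ∑ j ∈ Finset.range (m / 2 + 1),
      (-1 : ℝ) ^ j / ((Nat.factorial j : ℝ) * (Nat.factorial (m - 2 * j) : ℝ)) *
        (2 * x) ^ (m - 2 * j)

/-- `z 1 < z 2 < … < z n` enumerates, in increasing order, all real zeros of `f`. -/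
def EnumZeros (f : ℝ → ℝ) (n : ℕ) (z : ℕ → ℝ) : Prop :=
  StrictMonoOn z (Set.Icc 1 n) ∧ ∀ x : ℝ, f x = 0 ↔ ∃ k, 1 ≤ k ∧ k ≤ n ∧ x = z k

open Polynomial in
/-- The generalized Laguerre polynomial as an element of `ℝ[X]`. -/
noncomputable def laguerrePoly (α : ℝ) (n : ℕ) : ℝ[X] :=
  ∑ k ∈ Finset.range (n + 1),
    monomial k ((-1 : ℝ) ^ k / (Nat.factorial k : ℝ) *
      ((∏ j ∈ Finset.Icc (k + 1) n, (α + (j : ℝ))) / (Nat.factorial (n - k) : ℝ)))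

namespace X1Laguerre

open Polynomial

lemma eval_laguerrePoly (α : ℝ) (n : ℕ) (x : ℝ) :
    (laguerrePoly α n).eval x = laguerreL α n x := by
  simp [laguerrePoly, laguerreL, eval_finsetSum]

lemma coeff_laguerrePoly_add (α : ℝ) (d k : ℕ) :
    (laguerrePoly α (k + d)).coeff k = (-1 : ℝ) ^ k / (Nat.factorial k : ℝ) *
      ((∏ j ∈ Finset.Icc (k + 1) (k + d), (α + (j : ℝ))) / (Nat.factorial d : ℝ)) := by
  rw [laguerrePoly, finsetSum_coeff, Finset.sum_eq_single k]
  · simp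
  · intro b _ hb
    exact coeff_monomial_of_ne _ hb.symm
  · intro h
    simp at h

lemma coeff_laguerrePoly_of_lt (α : ℝ) {n k : ℕ} (h : n < k) :
    (laguerrePoly α n).coeff k = 0 := by
  rw [laguerrePoly, finsetSum_coeff]
  refine Finset.sum_eq_zero fun b hb => coeff_monomial_of_ne _ ?_
  have := Finset.mem_range.1 hb
  omega

/-- Raising the degree: `(n + 1 - k) c(n + 1, k) = (n + 1 + α) c(n, k)`. -/
lemma coeff_laguerrePoly_succ_degree (α : ℝ) (n k : ℕ) :
    ((n : ℝ) + 1 - k) * (laguerrePoly α (n + 1)).coeff k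
      = (n + 1 + α) * (laguerrePoly α n).coeff k := by
  rcases le_or_gt k n with h | h
  · obtain ⟨d, rfl⟩ := Nat.exists_eq_add_of_le h
    rw [coeff_laguerrePoly_add, add_assoc k d 1, coeff_laguerrePoly_add, ← add_assoc k d 1,
      Finset.prod_Icc_succ_top (by omega), Nat.factorial_succ]
    push_cast
    field_simp
    ring
  · rw [coeff_laguerrePoly_of_lt α h]
    rcases (Nat.succ_le_of_lt h).eq_or_lt with h' | h'
    · rw [← h']
      push_cast
      ring
    · rw [coeff_laguerrePoly_of_lt α h']
      ring

/-- Raising the index: `(k + 1) (k + 1 + α) c(n, k + 1) = -(n - k) c(n, k)`. -/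
lemma coeff_laguerrePoly_succ_index (α : ℝ) (hα : 0 < α) {n k : ℕ} (h : k ≤ n) :
    ((k : ℝ) + 1) * (k + 1 + α) * (laguerrePoly α n).coeff (k + 1)
      = -((n : ℝ) - k) * (laguerrePoly α n).coeff k := by
  rcases h.eq_or_lt with rfl | h
  · rw [coeff_laguerrePoly_of_lt α (Nat.lt_succ_self k)]
    ring
  · obtain ⟨d, rfl⟩ := Nat.exists_eq_add_of_lt h
    have h1 := coeff_laguerrePoly_add α d (k + 1)
    have h2 := coeff_laguerrePoly_add α (d + 1) k
    rw [show k + 1 + d = k + d + 1 by ring] at h1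
    rw [show k + (d + 1) = k + d + 1 by ring,
      ← Finset.prod_Ioc_mul_eq_prod_Icc (show k + 1 ≤ k + d + 1 by omega)] at h2
    have h3 : Finset.Ioc (k + 1) (k + d + 1) = Finset.Icc (k + 1 + 1) (k + d + 1) := by
      ext
      simp only [Finset.mem_Ioc, Finset.mem_Icc]
      omega
    rw [h3] at h2
    rw [h1, h2, Nat.factorial_succ, Nat.factorial_succ]
    push_cast
    field_simp
    ring

lemma X_mul_derivative_laguerrePoly (α : ℝ) (n : ℕ) :
    X * derivative (laguerrePoly α (n + 1))
      = C ((n : ℝ) + 1) * laguerrePoly α (n + 1) - C ((n : ℝ) + 1 + α) * laguerrePoly α n := by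
  ext k
  have h := coeff_laguerrePoly_succ_degree α n k
  rw [coeff_sub, coeff_C_mul, coeff_C_mul]
  rcases k with _ | k
  · rw [coeff_X_mul_zero]
    push_cast at h
    linarith
  · rw [coeff_X_mul, coeff_derivative]
    push_cast at h
    linarith

lemma derivative_laguerrePoly_succ (α : ℝ) (hα : 0 < α) (n : ℕ) :
    derivative (laguerrePoly α (n + 1)) = derivative (laguerrePoly α n) - laguerrePoly α n := by
  ext k
  rw [coeff_sub, coeff_derivative, coeff_derivative]
  rcases lt_trichotomy k n with h | rfl | h
  · have h1 := coeff_laguerrePoly_succ_degree α n (k + 1)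
    have h2 := coeff_laguerrePoly_succ_index α hα h.le
    have h3 : (n : ℝ) - k ≠ 0 := sub_ne_zero.2 (by exact_mod_cast h.ne')
    push_cast at h1
    apply mul_left_cancel₀ h3
    linear_combination ((k : ℝ) + 1) * h1 + h2
  · have h1 := coeff_laguerrePoly_succ_degree α k k
    have h2 := coeff_laguerrePoly_succ_index α hα (Nat.le_succ k)
    have h3 : (k : ℝ) + 1 + α ≠ 0 := by positivity
    rw [coeff_laguerrePoly_of_lt α (Nat.lt_succ_self k)]
    push_cast at h2
    apply mul_left_cancel₀ h3
    linear_combination h2 - h1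
  · rw [coeff_laguerrePoly_of_lt α h, coeff_laguerrePoly_of_lt α (show n < k + 1 by omega),
      coeff_laguerrePoly_of_lt α (show n + 1 < k + 1 by omega)]
    ring

lemma laguerreL_pos (α : ℝ) (hα : 0 < α) (n : ℕ) {x : ℝ} (hx : x ≤ 0) :
    0 < laguerreL α n x := by
  have key : ∀ k, (-1 : ℝ) ^ k / (Nat.factorial k : ℝ) *
      ((∏ j ∈ Finset.Icc (k + 1) n, (α + (j : ℝ))) / (Nat.factorial (n - k) : ℝ)) * x ^ k
      = (∏ j ∈ Finset.Icc (k + 1) n, (α + (j : ℝ)))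
        / ((Nat.factorial k : ℝ) * (Nat.factorial (n - k) : ℝ)) * (-x) ^ k := by
    intro k
    rw [neg_pow x k]
    field_simp
  have hprod : ∀ k, 0 < ∏ j ∈ Finset.Icc (k + 1) n, (α + (j : ℝ)) :=
    fun k => Finset.prod_pos fun j _ => by positivity
  have hx' : 0 ≤ -x := by linarith
  unfold laguerreL
  refine Finset.sum_pos' (fun k _ => ?_) ⟨0, by simp, ?_⟩
  · rw [key]
    have := hprod k
    positivity
  · rw [key]
    have := hprod 0
    positivity

/-- The X₁-Laguerre polynomial of degree `n + 1` as an element of `ℝ[X]`. -/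
noncomputable def poly (α : ℝ) : ℕ → ℝ[X]
  | 0 => -(X + C (α + 1))
  | n + 1 => -(X + C (α + 1)) * laguerrePoly α (n + 1) + laguerrePoly α n

lemma eval_poly (α : ℝ) (n : ℕ) (x : ℝ) : (poly α n).eval x = X1laguerreL α (n + 1) x := by
  rcases n with _ | n
  · simp [poly, X1laguerreL, laguerreL]
    ring
  · simp only [poly, X1laguerreL, eval_add, eval_mul, eval_neg, eval_X, eval_C, eval_laguerrePoly,
      Nat.add_sub_cancel, if_pos (show 2 ≤ n + 1 + 1 by omega),
      show n + 1 + 1 - 2 = n by omega]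
    ring

/-- `y` solves the X₁-Laguerre differential equation with eigenvalue `c`. -/
def IsSolution (α c : ℝ) (y : ℝ[X]) : Prop :=
  -X * (X + C α) * derivative (derivative y)
    + (X - C α) * ((X + C α + 1) * derivative y - y) = C c * (X + C α) * y

lemma isSolution_poly (α : ℝ) (hα : 0 < α) (n : ℕ) : IsSolution α n (poly α n) := by
  unfold IsSolution
  rcases n with _ | n
  · simp only [poly, derivative_neg, derivative_X, derivative_C, derivative_one, map_add,
      map_one, Nat.cast_zero, map_zero]
    ring
  · have h1 := X_mul_derivative_laguerrePoly α n
    have h2 := derivative_laguerrePoly_succ α hα n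
    have h3 := congrArg derivative h1
    have h4 := congrArg derivative h2
    simp only [poly]
    simp only [derivative_mul, derivative_sub, derivative_neg, derivative_X,
      derivative_C, map_add, map_one, Nat.cast_add, Nat.cast_one, zero_mul, zero_add, add_zero,
      one_mul, derivative_one] at *
    generalize derivative (derivative (laguerrePoly α (n + 1))) = A2 at *
    generalize derivative (derivative (laguerrePoly α n)) = B2 at *
    generalize derivative (laguerrePoly α (n + 1)) = A1 at *
    generalize derivative (laguerrePoly α n) = B1 at *
    generalize laguerrePoly α (n + 1) = A at *
    generalize laguerrePoly α n = B at *
    have e1 : B1 = A1 + B := by linear_combination -h2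
    have e2 : B2 = A2 + A1 + B := by linear_combination -h4 + e1
    subst e2 e1
    linear_combination (X + C α) * (X + C α) * h3 - (X + C α) * (X + C α + 1) * h1

lemma IsSolution.neg {α c : ℝ} {y : ℝ[X]} (h : IsSolution α c y) : IsSolution α c (-y) := by
  unfold IsSolution at *
  simp only [derivative_neg]
  linear_combination -h

/-- The weighted Wronskian of two polynomials. -/
noncomputable def wronskian (α : ℝ) (y Y : ℝ[X]) (x : ℝ) : ℝ :=
  x ^ (α + 1) * Real.exp (-x) / (x + α) ^ 2 *
    (derivative y * Y - y * derivative Y).eval x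

lemma hasDerivAt_wronskian {α c : ℝ} (hα : 0 < α) {y Y : ℝ[X]} (hy : IsSolution α c y)
    (hY : IsSolution α (c + 1) Y) {x : ℝ} (hx : 0 < x) :
    HasDerivAt (wronskian α y Y)
      (x ^ α * Real.exp (-x) / (x + α) ^ 2 * (y.eval x * Y.eval x)) x := by
  have hxα : x + α ≠ 0 := by positivity
  have h1 : HasDerivAt (fun x : ℝ => x ^ (α + 1)) ((α + 1) * x ^ α) x := by
    simpa using Real.hasDerivAt_rpow_const (x := x) (p := α + 1) (Or.inl hx.ne')
  have h2 : HasDerivAt (fun x : ℝ => Real.exp (-x)) (-Real.exp (-x)) x := by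
    simpa using (hasDerivAt_neg x).exp
  have h3 : HasDerivAt (fun x : ℝ => (x + α) ^ 2) (2 * (x + α)) x := by
    simpa using ((hasDerivAt_id' x).add_const α).fun_pow 2
  have h4 := (derivative y * Y - y * derivative Y).hasDerivAt x
  have h5 := ((h1.mul h2).div h3 (pow_ne_zero 2 hxα)).mul h4
  have e1 := congrArg (eval x) hy
  have e2 := congrArg (eval x) hY
  simp only [eval_add, eval_mul, eval_neg, eval_sub, eval_X, eval_C, eval_one] at e1 e2
  refine h5.congr_deriv ?_
  simp only [derivative_sub, derivative_mul, eval_add, eval_mul, eval_sub, Pi.mul_apply,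
    Pi.div_apply]
  rw [Real.rpow_add_one hx.ne']
  generalize eval x (derivative (derivative y)) = y2 at *
  generalize eval x (derivative (derivative Y)) = Y2 at *
  generalize eval x (derivative y) = y1 at *
  generalize eval x (derivative Y) = Y1 at *
  generalize eval x y = y0 at *
  generalize eval x Y = Y0 at *
  generalize x ^ α = u at *
  generalize Real.exp (-x) = v at *
  field_simp
  linear_combination u * v * (Y0 * -e1 + y0 * e2)

lemma continuousOn_wronskian {α : ℝ} (hα : 0 < α) (y Y : ℝ[X]) :
    ContinuousOn (wronskian α y Y) (Set.Ici 0) := by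
  unfold wronskian
  refine ContinuousOn.mul (ContinuousOn.div ?_ ?_ ?_) (Polynomial.continuousOn _)
  · exact ((Real.continuous_rpow_const (by linarith)).mul (by fun_prop)).continuousOn
  · fun_prop
  · intro x hx
    have : (0 : ℝ) ≤ x := hx
    positivity

lemma tendsto_wronskian {α : ℝ} (y Y : ℝ[X]) :
    Tendsto (wronskian α y Y) atTop (nhds 0) := by
  have hq : ∀ q : ℝ[X], Tendsto (fun x : ℝ => x ^ (α + 1) * Real.exp (-x) * q.eval x)
      atTop (nhds 0) := by
    intro q
    have hexp : Tendsto (fun x : ℝ => x ^ (α + 1) * Real.exp (-(1 / 2) * x)) atTop (nhds 0) :=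
      tendsto_rpow_mul_exp_neg_mul_atTop_nhds_zero _ _ (by norm_num)
    have hpol : Tendsto (fun x : ℝ => Real.exp (-(1 / 2) * x) * q.eval x) atTop (nhds 0) := by
      induction q using Polynomial.induction_on' with
      | add p q hp hq => simpa [mul_add] using hp.add hq
      | monomial k a =>
        have h := (tendsto_rpow_mul_exp_neg_mul_atTop_nhds_zero (k : ℝ) (1 / 2)
          (by norm_num)).const_mul a
        rw [mul_zero] at h
        refine h.congr fun x => ?_
        simp only [eval_monomial, Real.rpow_natCast]
        ring
    have h := hexp.mul hpol
    rw [mul_zero] at h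
    refine h.congr fun x => ?_
    have : Real.exp (-x) = Real.exp (-(1 / 2) * x) * Real.exp (-(1 / 2) * x) := by
      rw [← Real.exp_add]
      ring_nf
    rw [this]
    ring
  have hden : Tendsto (fun x : ℝ => ((x + α) ^ 2)⁻¹) atTop (nhds 0) :=
    tendsto_inv_atTop_zero.comp
      ((tendsto_pow_atTop two_ne_zero).comp (tendsto_atTop_add_const_right _ α tendsto_id))
  have h := (hq (derivative y * Y - y * derivative Y)).mul hden
  rw [mul_zero] at h
  refine h.congr fun x => ?_
  rw [wronskian]
  ring

lemma eval_nonneg_left {y : ℝ[X]} {a b : ℝ} (hab : a < b)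
    (hy : ∀ x ∈ Set.Ioo a b, 0 < y.eval x) : 0 ≤ y.eval a := by
  refine ge_of_tendsto (y.continuous.continuousAt.tendsto.mono_left
    (nhdsWithin_le_nhds (s := Set.Ioi a))) ?_
  filter_upwards [Ioo_mem_nhdsGT hab] with x hx using (hy x hx).le

lemma eval_nonneg_right {y : ℝ[X]} {a b : ℝ} (hab : a < b)
    (hy : ∀ x ∈ Set.Ioo a b, 0 < y.eval x) : 0 ≤ y.eval b := by
  refine ge_of_tendsto (y.continuous.continuousAt.tendsto.mono_left
    (nhdsWithin_le_nhds (s := Set.Iio b))) ?_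
  filter_upwards [Ioo_mem_nhdsLT hab] with x hx using (hy x hx).le

lemma eval_derivative_nonneg {y : ℝ[X]} {a b : ℝ} (hab : a < b) (ha : y.eval a = 0)
    (hy : ∀ x ∈ Set.Ioo a b, 0 < y.eval x) : 0 ≤ (derivative y).eval a := by
  have h := ((hasDerivAt_iff_tendsto_slope).1 (y.hasDerivAt a)).mono_left
    (nhdsWithin_mono a (fun x (hx : x ∈ Set.Ioi a) => ne_of_gt hx))
  refine ge_of_tendsto h ?_
  filter_upwards [Ioo_mem_nhdsGT hab] with x hx
  rw [slope_def_field, ha, sub_zero]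
  exact div_nonneg (hy x hx).le (sub_nonneg.2 hx.1.le)

lemma eval_derivative_nonpos {y : ℝ[X]} {a b : ℝ} (hab : a < b) (hb : y.eval b = 0)
    (hy : ∀ x ∈ Set.Ioo a b, 0 < y.eval x) : (derivative y).eval b ≤ 0 := by
  have h := ((hasDerivAt_iff_tendsto_slope).1 (y.hasDerivAt b)).mono_left
    (nhdsWithin_mono b (fun x (hx : x ∈ Set.Iio b) => ne_of_lt hx))
  refine le_of_tendsto h ?_
  filter_upwards [Ioo_mem_nhdsLT hab] with x hx
  rw [slope_def_field, hb, sub_zero]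
  exact div_nonpos_of_nonneg_of_nonpos (hy x hx).le (sub_nonpos.2 hx.2.le)

lemma wronskian_left_nonneg {α : ℝ} (hα : 0 < α) {y Y : ℝ[X]} {a b : ℝ} (ha : 0 ≤ a)
    (hab : a < b) (hya : a = 0 ∨ y.eval a = 0) (hy : ∀ x ∈ Set.Ioo a b, 0 < y.eval x)
    (hY : ∀ x ∈ Set.Ioo a b, 0 < Y.eval x) : 0 ≤ wronskian α y Y a := by
  rcases hya with rfl | hya
  · rw [wronskian, Real.zero_rpow (by positivity)]
    simp
  · rw [wronskian, eval_sub, eval_mul, eval_mul, hya]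
    have h1 := eval_derivative_nonneg hab hya hy
    have h2 := eval_nonneg_left hab hY
    rw [zero_mul, sub_zero]
    positivity

lemma wronskian_right_nonpos {α : ℝ} {y Y : ℝ[X]} {a b : ℝ} (ha : 0 ≤ a)
    (hab : a < b) (hyb : y.eval b = 0) (hy : ∀ x ∈ Set.Ioo a b, 0 < y.eval x)
    (hY : ∀ x ∈ Set.Ioo a b, 0 < Y.eval x) : wronskian α y Y b ≤ 0 := by
  rw [wronskian, eval_sub, eval_mul, eval_mul, hyb]
  have h1 := eval_derivative_nonpos hab hyb hy
  have h2 := eval_nonneg_right hab hY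
  have hb : 0 ≤ b := ha.trans hab.le
  rw [zero_mul, sub_zero]
  exact mul_nonpos_of_nonneg_of_nonpos (by positivity) (mul_nonpos_of_nonpos_of_nonneg h1 h2)

lemma strictMonoOn_wronskian {α c : ℝ} (hα : 0 < α) {y Y : ℝ[X]} (hy : IsSolution α c y)
    (hY : IsSolution α (c + 1) Y) {s : Set ℝ} (hs : Convex ℝ s) (hs0 : s ⊆ Set.Ici 0)
    (hpos : ∀ x ∈ interior s, 0 < y.eval x ∧ 0 < Y.eval x) :
    StrictMonoOn (wronskian α y Y) s := by
  refine strictMonoOn_of_deriv_pos hs ((continuousOn_wronskian hα y Y).mono hs0) fun x hx => ?_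
  have hx0 : 0 < x := by
    have := interior_mono hs0 hx
    rwa [interior_Ici] at this
  rw [(hasDerivAt_wronskian hα hy hY hx0).deriv]
  obtain ⟨h1, h2⟩ := hpos x hx
  positivity

/-- Two solutions with consecutive eigenvalues cannot both be positive between two consecutive
zeros of the first one. -/
lemma not_both_pos_Ioo {α c : ℝ} (hα : 0 < α) {y Y : ℝ[X]} (hy : IsSolution α c y)
    (hY : IsSolution α (c + 1) Y) {a b : ℝ} (ha : 0 ≤ a) (hab : a < b)
    (hya : a = 0 ∨ y.eval a = 0) (hyb : y.eval b = 0) (py : ∀ x ∈ Set.Ioo a b, 0 < y.eval x)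
    (pY : ∀ x ∈ Set.Ioo a b, 0 < Y.eval x) : False := by
  have hm := strictMonoOn_wronskian hα hy hY (convex_Icc a b)
    (fun x hx => ha.trans hx.1) (by
      rw [interior_Icc]
      exact fun x hx => ⟨py x hx, pY x hx⟩)
  have := hm (Set.left_mem_Icc.2 hab.le) (Set.right_mem_Icc.2 hab.le) hab
  have := wronskian_left_nonneg hα ha hab hya py pY
  have := wronskian_right_nonpos (α := α) ha hab hyb py pY
  linarith

lemma not_both_pos_Ioi {α c : ℝ} (hα : 0 < α) {y Y : ℝ[X]} (hy : IsSolution α c y)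
    (hY : IsSolution α (c + 1) Y) {a : ℝ} (ha : 0 ≤ a)
    (hya : a = 0 ∨ y.eval a = 0) (py : ∀ x ∈ Set.Ioi a, 0 < y.eval x)
    (pY : ∀ x ∈ Set.Ioi a, 0 < Y.eval x) : False := by
  have hm := strictMonoOn_wronskian hα hy hY (convex_Ici a)
    (fun x hx => ha.trans hx) (by
      rw [interior_Ici]
      exact fun x hx => ⟨py x hx, pY x hx⟩)
  have h1 : a < a + 1 := by linarith
  have h2 := hm Set.self_mem_Ici h1.le h1
  have h3 := wronskian_left_nonneg hα ha h1 hya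
    (fun x hx => py x hx.1) (fun x hx => pY x hx.1)
  have h4 : wronskian α y Y (a + 1) ≤ 0 := by
    refine ge_of_tendsto (tendsto_wronskian (α := α) y Y) ?_
    filter_upwards [eventually_ge_atTop (a + 1)] with x hx
    exact hm.monotoneOn h1.le (h1.le.trans hx) hx
  linarith

lemma pos_or_neg_of_ne_zero {s : Set ℝ} (hs : IsPreconnected s) {y : ℝ[X]}
    (h : ∀ x ∈ s, y.eval x ≠ 0) :
    (∀ x ∈ s, 0 < y.eval x) ∨ ∀ x ∈ s, 0 < (-y).eval x := by
  by_contra! hc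
  obtain ⟨⟨u, hu, hu'⟩, v, hv, hv'⟩ := hc
  rw [eval_neg] at hv'
  obtain ⟨w, hw, hw'⟩ := hs.intermediate_value hu hv y.continuous.continuousOn
    (show (0 : ℝ) ∈ Set.Icc _ _ from ⟨hu', by linarith⟩)
  exact h w hw hw'

lemma exists_zero_of_not_both_pos {α c : ℝ} {s : Set ℝ} (hs : IsPreconnected s) {y Y : ℝ[X]}
    (hy : IsSolution α c y) (hY : IsSolution α (c + 1) Y) (hne : ∀ x ∈ s, y.eval x ≠ 0)
    {p : ℝ[X] → Prop} (hp : p y) (hp' : p (-y))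
    (hnot : ∀ u v : ℝ[X], p u → IsSolution α c u → IsSolution α (c + 1) v →
      (∀ x ∈ s, 0 < u.eval x) → (∀ x ∈ s, 0 < v.eval x) → False) :
    ∃ x ∈ s, Y.eval x = 0 := by
  by_contra! hc
  rcases pos_or_neg_of_ne_zero hs hne with h1 | h1 <;>
    rcases pos_or_neg_of_ne_zero hs hc with h2 | h2
  · exact hnot _ _ hp hy hY h1 h2
  · exact hnot _ _ hp hy hY.neg h1 h2
  · exact hnot _ _ hp' hy.neg hY h1 h2
  · exact hnot _ _ hp' hy.neg hY.neg h1 h2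

lemma exists_zero_Ioo {α c : ℝ} (hα : 0 < α) {y Y : ℝ[X]} (hy : IsSolution α c y)
    (hY : IsSolution α (c + 1) Y) {a b : ℝ} (ha : 0 ≤ a) (hab : a < b)
    (hya : a = 0 ∨ y.eval a = 0) (hyb : y.eval b = 0)
    (hne : ∀ x ∈ Set.Ioo a b, y.eval x ≠ 0) : ∃ x ∈ Set.Ioo a b, Y.eval x = 0 :=
  exists_zero_of_not_both_pos isPreconnected_Ioo hy hY hne
    (p := fun u => (a = 0 ∨ u.eval a = 0) ∧ u.eval b = 0) ⟨hya, hyb⟩ (by simp [hya, hyb])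
    fun _ _ hp hu hv => not_both_pos_Ioo hα hu hv ha hab hp.1 hp.2

lemma exists_zero_Ioi {α c : ℝ} (hα : 0 < α) {y Y : ℝ[X]} (hy : IsSolution α c y)
    (hY : IsSolution α (c + 1) Y) {a : ℝ} (ha : 0 ≤ a) (hya : a = 0 ∨ y.eval a = 0)
    (hne : ∀ x ∈ Set.Ioi a, y.eval x ≠ 0) : ∃ x ∈ Set.Ioi a, Y.eval x = 0 :=
  exists_zero_of_not_both_pos isPreconnected_Ioi hy hY hne
    (p := fun u => a = 0 ∨ u.eval a = 0) hya (by simp [hya])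
    fun _ _ hp hu hv => not_both_pos_Ioi hα hu hv ha hp

lemma exists_neg_zero (α : ℝ) (hα : 0 < α) (n : ℕ) : ∃ x < 0, (poly α n).eval x = 0 := by
  rcases n with _ | n
  · exact ⟨-(α + 1), by linarith, by simp [poly]⟩
  · have h0 : (poly α (n + 1)).eval 0 < 0 := by
      have h := congrArg (eval 0) (X_mul_derivative_laguerrePoly α n)
      simp only [eval_mul, eval_X, eval_sub, eval_C, zero_mul, eval_laguerrePoly] at h
      have h1 := laguerreL_pos α hα n le_rfl
      have h2 := laguerreL_pos α hα (n + 1) le_rfl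
      simp only [poly, eval_add, eval_mul, eval_neg, eval_X, eval_C, eval_laguerrePoly]
      have h3 : laguerreL α n 0 < laguerreL α (n + 1) 0 := by
        have hn : (0 : ℝ) < (n : ℝ) + 1 := by positivity
        nlinarith [mul_pos hα h1]
      nlinarith [mul_pos hα h2]
    have h1 : 0 < (poly α (n + 1)).eval (-(α + 1)) := by
      have := laguerreL_pos α hα n (show -(α + 1) ≤ 0 by linarith)
      simpa [poly, eval_laguerrePoly] using this
    obtain ⟨w, hw, hw'⟩ := intermediate_value_Ioo' (show -(α + 1) ≤ 0 by linarith)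
      (poly α (n + 1)).continuous.continuousOn
      (show (0 : ℝ) ∈ Set.Ioo _ _ from ⟨h0, h1⟩)
    exact ⟨w, hw.2, hw'⟩

/-- A strictly increasing map from `{1, …, m}` to `{2, …, m + 1}` is the shift. -/
lemma eq_succ_of_strictly_increasing {m : ℕ} (j : ℕ → ℕ) (h1 : 2 ≤ j 1) (hm : j m ≤ m + 1)
    (hj : ∀ k, 1 ≤ k → k < m → j k < j (k + 1)) {k : ℕ} (hk : 1 ≤ k) (hkm : k ≤ m) :
    j k = k + 1 := by
  have lower : ∀ k, 1 ≤ k → k ≤ m → k + 1 ≤ j k := by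
    intro k hk
    induction k, hk using Nat.le_induction with
    | base => exact fun _ => h1
    | succ k hk ih =>
      intro h
      have := ih (by omega)
      have := hj k hk (by omega)
      omega
  have upper : ∀ d k, 1 ≤ k → k + d = m → j k ≤ k + 1 := by
    intro d
    induction d with
    | zero =>
      rintro k _ rfl
      exact hm
    | succ d ih =>
      intro k hk h
      have := ih (k + 1) (by omega) (by omega)
      have := hj k hk (by omega)
      omega
  exact le_antisymm (upper (m - k) k hk (by omega)) (lower k hk hkm)

/-- If the regular zeros of the polynomial of degree `m` are positive, they interlace with those
of the polynomial of degree `m + 1`, whose regular zeros are positive too. -/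
lemma interlace_step {α : ℝ} (hα : 0 < α) {m : ℕ} (hm : 1 ≤ m) {x y : ℕ → ℝ}
    (hx : EnumZeros (X1laguerreL α m) m x) (hy : EnumZeros (X1laguerreL α (m + 1)) (m + 1) y)
    (hpos : ∀ k, 2 ≤ k → k ≤ m → 0 < x k) :
    0 < y 2 ∧ ∀ k, 2 ≤ k → k ≤ m → y k < x k ∧ x k < y (k + 1) := by
  obtain ⟨m, rfl⟩ := Nat.exists_eq_add_of_le' hm
  obtain ⟨hxm, hx0⟩ := hx
  obtain ⟨hym, hy0⟩ := hy
  simp only [← eval_poly] at hx0 hy0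
  have first_neg : ∀ (n : ℕ) (u : ℕ → ℝ), StrictMonoOn u (Set.Icc 1 (n + 1)) →
      (∀ t : ℝ, (poly α n).eval t = 0 ↔ ∃ k, 1 ≤ k ∧ k ≤ n + 1 ∧ t = u k) → u 1 < 0 := by
    intro n u hu hu0
    obtain ⟨w, hw, hw0⟩ := exists_neg_zero α hα n
    obtain ⟨k, hk1, hk2, rfl⟩ := (hu0 w).1 hw0
    exact (hu.monotoneOn ⟨le_rfl, by omega⟩ ⟨hk1, hk2⟩ hk1).trans_lt hw
  have hx1 := first_neg m x hxm hx0
  have hy1 := first_neg (m + 1) y hym hy0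
  have sol := isSolution_poly α hα m
  have sol' : IsSolution α ((m : ℝ) + 1) (poly α (m + 1)) := by
    simpa using isSolution_poly α hα (m + 1)
  let lo : ℕ → ℝ := fun k => if k = 1 then 0 else x k
  have lo_one : lo 1 = 0 := if_pos rfl
  have lo_of_two_le : ∀ k, 2 ≤ k → lo k = x k := fun k hk => if_neg (by omega)
  have lo_nonneg : ∀ k, 1 ≤ k → k ≤ m + 1 → 0 ≤ lo k := by
    intro k h1 h2
    rcases h1.eq_or_lt with rfl | h
    · exact lo_one.ge
    · rw [lo_of_two_le k h]
      exact (hpos k h h2).le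
  have lo_zero : ∀ k, 1 ≤ k → k ≤ m + 1 → lo k = 0 ∨ (poly α m).eval (lo k) = 0 := by
    intro k h1 h2
    rcases h1.eq_or_lt with rfl | h
    · exact Or.inl lo_one
    · exact Or.inr ((hx0 _).2 ⟨k, h1, h2, lo_of_two_le k h⟩)
  have index_gt : ∀ k, 1 ≤ k → k ≤ m + 1 → ∀ i, 1 ≤ i → i ≤ m + 1 → lo k < x i → k < i := by
    intro k h1 h2 i hi1 hi2 hlt
    rcases h1.eq_or_lt with rfl | h
    · by_contra hc
      obtain rfl : i = 1 := by omega
      linarith [lo_one]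
    · rw [lo_of_two_le k h] at hlt
      exact (hxm.lt_iff_lt ⟨h1, h2⟩ ⟨hi1, hi2⟩).1 hlt
  have key : ∀ k, ∃ i, 1 ≤ k → k ≤ m + 1 → 1 ≤ i ∧ i ≤ m + 2 ∧ lo k < y i ∧
      (k < m + 1 → y i < x (k + 1)) := by
    intro k
    by_cases hk : 1 ≤ k ∧ k ≤ m + 1
    swap
    · exact ⟨0, fun h1 h2 => (hk ⟨h1, h2⟩).elim⟩
    obtain ⟨h1, h2⟩ := hk
    rcases h2.eq_or_lt with hkm | hkm
    · obtain ⟨w, hw, hw0⟩ := exists_zero_Ioi hα sol sol' (lo_nonneg k h1 h2) (lo_zero k h1 h2) (by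
        intro w hw hw0
        obtain ⟨i, hi1, hi2, rfl⟩ := (hx0 w).1 hw0
        have := index_gt k h1 h2 i hi1 hi2 hw
        omega)
      obtain ⟨i, hi1, hi2, rfl⟩ := (hy0 w).1 hw0
      exact ⟨i, fun _ _ => ⟨hi1, hi2, hw, fun h => by omega⟩⟩
    · have hlt : lo k < x (k + 1) := by
        rcases h1.eq_or_lt with rfl | h
        · rw [lo_one]
          exact hpos 2 le_rfl (by omega)
        · rw [lo_of_two_le k h]
          exact hxm ⟨h1, h2⟩ ⟨by omega, by omega⟩ (Nat.lt_succ_self k)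
      obtain ⟨w, hw, hw0⟩ := exists_zero_Ioo hα sol sol' (lo_nonneg k h1 h2) hlt
        (lo_zero k h1 h2) ((hx0 _).2 ⟨k + 1, by omega, by omega, rfl⟩) (by
          intro w hw hw0
          obtain ⟨i, hi1, hi2, rfl⟩ := (hx0 w).1 hw0
          have := index_gt k h1 h2 i hi1 hi2 hw.1
          have := (hxm.lt_iff_lt ⟨hi1, hi2⟩ ⟨by omega, by omega⟩).1 hw.2
          omega)
      obtain ⟨i, hi1, hi2, rfl⟩ := (hy0 w).1 hw0
      exact ⟨i, fun _ _ => ⟨hi1, hi2, hw.1, fun _ => hw.2⟩⟩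
  choose j hj using key
  have hjk : ∀ k, 1 ≤ k → k ≤ m + 1 → j k = k + 1 := by
    intro k
    refine eq_succ_of_strictly_increasing j ?_ ?_ ?_
    · obtain ⟨h1, h2, h3, -⟩ := hj 1 le_rfl (by omega)
      by_contra hc
      have h4 : j 1 = 1 := by omega
      rw [h4, lo_one] at h3
      linarith
    · exact (hj (m + 1) (by omega) le_rfl).2.1
    · intro k h1 h2
      obtain ⟨a1, a2, -, a4⟩ := hj k h1 h2.le
      obtain ⟨b1, b2, b3, -⟩ := hj (k + 1) (by omega) h2
      rw [lo_of_two_le (k + 1) (by omega)] at b3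
      exact (hym.lt_iff_lt ⟨a1, a2⟩ ⟨b1, b2⟩).1 ((a4 h2).trans b3)
  refine ⟨?_, fun k h1 h2 => ⟨?_, ?_⟩⟩
  · have h := (hj 1 le_rfl (by omega)).2.2.1
    rwa [hjk 1 le_rfl (by omega), lo_one] at h
  · have h := (hj (k - 1) (by omega) (by omega)).2.2.2 (by omega)
    rwa [hjk (k - 1) (by omega) (by omega), Nat.sub_add_cancel (by omega)] at h
  · have h := (hj k (by omega) h2).2.2.1
    rwa [hjk k (by omega) h2, lo_of_two_le k h1] at h

end X1Laguerre

/-- For `α > 0` and `n ≥ 2`, the regular zeros of X₁-Laguerre polynomials of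
consecutive degrees interlace:
`0 < x̂_{n+1,2}` and `x̂_{n+1,k} < x̂_{n,k} < x̂_{n+1,k+1}` for `2 ≤ k ≤ n`. -/
theorem X1laguerre_regular_zeros_interlace
    (α : ℝ) (hα : 0 < α) (n : ℕ) (hn : 2 ≤ n)
    (z : ℕ → ℕ → ℝ)
    (hz : ∀ m : ℕ, 1 ≤ m → EnumZeros (X1laguerreL α m) m (z m)) :
    0 < z (n + 1) 2 ∧
      ∀ k : ℕ, 2 ≤ k → k ≤ n → z (n + 1) k < z n k ∧ z n k < z (n + 1) (k + 1) := by
  have regular_pos : ∀ m, 1 ≤ m → ∀ k, 2 ≤ k → k ≤ m → 0 < z m k := by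
    intro m hm
    induction m, hm using Nat.le_induction with
    | base =>
      intro k h1 h2
      omega
    | succ m hm ih =>
      intro k h1 h2
      have h := (X1Laguerre.interlace_step hα hm (hz m hm) (hz (m + 1) (by omega)) ih).1
      exact h.trans_le ((hz (m + 1) (by omega)).1.monotoneOn ⟨by omega, by omega⟩
        ⟨by omega, h2⟩ h1)
  exact X1Laguerre.interlace_step hα (by omega) (hz n (by omega)) (hz (n + 1) (by omega))
    (regular_pos n (by omega))
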